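/- For every order O ⊆ B_p, one has O = {x ∈ B_p : 2x ∈ ℤ + O^T and Nr(x) ∈ ℤ}, where ℤ + O^T = {a + t : a ∈ ℤ, t ∈ O^T}. -/

import Mathlib

open scoped Quaternion

/-- The rational quaternion algebra with `i² = -p`, `j² = -q`. -/
abbrev Bq (p q : ℕ) := ℍ[ℚ, -(p : ℚ), -(q : ℚ)]

namespace GrossPaper

variable {p q : ℕ}

/-- The (reduced) trace `Tr(x) = x + x̄` of a quaternion, as a rational number. -/
def Trq (x : Bq p q) : ℚ := 2 * x.re

/-- The (reduced) norm `Nr(x) = x·x̄` of a quaternion, as a rational number. -/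
def Nrq (x : Bq p q) : ℚ := (x * star x).re

/-- The inverse of a nonzero quaternion: `c⁻¹ = star c / Nr c`. -/
noncomputable def qinv (c : Bq p q) : Bq p q := (Nrq c)⁻¹ • star c

/-- Conjugation of a set: `c S c⁻¹`. -/
noncomputable def conjSet (c : Bq p q) (S : Set (Bq p q)) : Set (Bq p q) :=
  (fun s => c * s * qinv c) '' S

/-- An order of `B_p`: a subring (hence containing `ℤ`) which is a free `ℤ`-module of
rank 4 spanning `B_p` over `ℚ`. -/
def IsOrder (O : Subring (Bq p q)) : Prop :=
  Nonempty (Module.Basis (Fin 4) ℤ O) ∧ Submodule.span ℚ (O : Set (Bq p q)) = ⊤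

/-- A maximal order: an order not properly contained in any other order. -/
def IsMaximalOrder (O : Subring (Bq p q)) : Prop :=
  IsOrder O ∧ ∀ O' : Subring (Bq p q), IsOrder O' → O ≤ O' → O' = O

/-- Two orders are of the same type if they are conjugate. -/
noncomputable def SameType (O O' : Subring (Bq p q)) : Prop :=
  ∃ c : Bq p q, c ≠ 0 ∧ conjSet c (O : Set (Bq p q)) = (O' : Set (Bq p q))

/-- The Gross lattice `O^T = {2x - Tr(x) : x ∈ O}`. -/
def GrossLat (O : Subring (Bq p q)) : Set (Bq p q) :=
  {t | ∃ x ∈ O, t = 2 * x - algebraMap ℚ (Bq p q) (Trq x)}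

/-- `SuccMin T i D` says `D` is the `i`-th successive minimum of `T`: the least real
number such that `T` contains `i` `ℚ`-linearly independent elements of norm at most `D`. -/
def SuccMin (T : Set (Bq p q)) (i : ℕ) (D : ℝ) : Prop :=
  IsLeast {r : ℝ | ∃ v : Fin i → Bq p q, (∀ n, v n ∈ T) ∧ LinearIndependent ℚ v ∧
    ∀ n, ((Nrq (v n) : ℝ) ≤ r)} D

/-- A primitive element of the Gross lattice. -/
def Primitive (T : Set (Bq p q)) (t : Bq p q) : Prop :=
  t ∈ T ∧ t ≠ 0 ∧ ∀ (a : ℤ) (s : Bq p q), s ∈ T → t = a • s → a = 1 ∨ a = -1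

/-- `k` is represented optimally by `T` : `Nr(t) = k` for some primitive `t ∈ T`. -/
def OptRep (T : Set (Bq p q)) (k : ℝ) : Prop :=
  ∃ t : Bq p q, Primitive T t ∧ (Nrq t : ℝ) = k

/-- The multiplicity `θ_T(k)`: half the number of `t ∈ T` with `Nr t = k`. -/
noncomputable def theta (T : Set (Bq p q)) (k : ℝ) : ℚ :=
  ({t : Bq p q | t ∈ T ∧ (Nrq t : ℝ) = k}.ncard : ℚ) / 2

/-- The optimal multiplicity `θ'_T(k)`: half the number of primitive `t ∈ T` with `Nr t = k`. -/
noncomputable def thetaOpt (T : Set (Bq p q)) (k : ℝ) : ℚ :=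
  ({t : Bq p q | Primitive T t ∧ (Nrq t : ℝ) = k}.ncard : ℚ) / 2

end GrossPaper

open GrossPaper

theorem Nrq_eq {p q : ℕ} (x : Bq p q) :
    Nrq x = x.re ^ 2 + p * x.imI ^ 2 + q * x.imJ ^ 2 + p * q * x.imK ^ 2 := by
  simp [Nrq]; ring

theorem quad {p q : ℕ} (x : Bq p q) :
    x * x - Trq x • x + algebraMap ℚ (Bq p q) (Nrq x) = 0 := by
  rw [Nrq_eq]
  ext <;> simp [Trq, QuaternionAlgebra.algebraMap_eq] <;> ring

theorem rat_int {r : ℚ} (h : IsIntegral ℤ r) : ∃ n : ℤ, r = n := by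
  obtain ⟨n, hn⟩ := IsIntegrallyClosed.isIntegral_iff.mp h
  exact ⟨n, by simpa using hn.symm⟩

open Polynomial in
theorem tr_nr {p q : ℕ} (x : Bq p q) (hx : IsIntegral ℤ x) :
    (∃ n : ℤ, Trq x = n) ∧ ∃ n : ℤ, Nrq x = n := by
  by_cases him : x.imI = 0 ∧ x.imJ = 0 ∧ x.imK = 0
  · obtain ⟨h1, h2, h3⟩ := him
    have hxr : algebraMap ℚ (Bq p q) x.re = x := by
      ext <;> simp [QuaternionAlgebra.algebraMap_eq, h1, h2, h3]
    have hr : IsIntegral ℤ x.re := by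
      rw [← hxr] at hx
      exact (isIntegral_algebraMap_iff (algebraMap ℚ (Bq p q)).injective).mp hx
    obtain ⟨n, hn⟩ := rat_int hr
    refine ⟨⟨2 * n, ?_⟩, ⟨n ^ 2, ?_⟩⟩
    · simp [Trq, hn]
    · simp [Nrq_eq, h1, h2, h3, hn]
  · obtain ⟨f, hf, hfx⟩ := hx
    set g : ℚ[X] := X ^ 2 + (C (-Trq x) * X + C (Nrq x)) with hg
    have hdl : (C (-Trq x) * X + C (Nrq x)).degree < 2 :=
      lt_of_le_of_lt degree_linear_le (by norm_num)
    have hgm : g.Monic := monic_X_pow_add hdl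
    have hgd : g.degree = 2 := by
      rw [hg, degree_add_eq_left_of_degree_lt]
      · simp
      · rw [degree_X_pow]; exact hdl
    have hgx : aeval x g = 0 := by
      have := quad x
      simp only [hg, map_add, map_mul, map_pow, aeval_X, aeval_C, map_neg]
      rw [← this, Algebra.smul_def, sq]
      noncomm_ring
    have hFx : aeval x (f.map (algebraMap ℤ ℚ)) = 0 := by
      rw [aeval_map_algebraMap]; exact hfx
    have hdvd : g ∣ f.map (algebraMap ℤ ℚ) := by
      rw [← modByMonic_eq_zero_iff_dvd hgm]
      set r := f.map (algebraMap ℤ ℚ) %ₘ g with hr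
      have hrx : aeval x r = 0 := by
        rw [hr, modByMonic_eq_sub_mul_div _ g, map_sub, map_mul, hgx, hFx]; simp
      have hrd : r.degree < 2 := hgd ▸ degree_modByMonic_lt _ hgm
      have hrd1 : r.degree ≤ 1 := Order.le_of_lt_succ hrd
      have he := eq_X_add_C_of_degree_le_one hrd1
      generalize r.coeff 1 = a at he
      generalize r.coeff 0 = b at he
      rw [he] at hrx
      simp only [map_add, map_mul, aeval_X, aeval_C] at hrx
      have e0 := congrArg QuaternionAlgebra.re hrx
      have e1 := congrArg QuaternionAlgebra.imI hrx
      have e2 := congrArg QuaternionAlgebra.imJ hrx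
      have e3 := congrArg QuaternionAlgebra.imK hrx
      simp [QuaternionAlgebra.algebraMap_eq] at e0 e1 e2 e3
      have ha : a = 0 := by
        by_contra hne
        simp [hne] at e1 e2 e3
        exact him ⟨e1, e2, e3⟩
      have hb : b = 0 := by simpa [ha] using e0
      rw [he, ha, hb]; simp
    have hl := integralClosure.mem_lifts_of_monic_of_dvd_map ℚ hf hgm hdvd
    rw [lifts_iff_coeff_lifts] at hl
    have key : ∀ n, ∃ m : ℤ, g.coeff n = m := by
      intro n
      obtain ⟨⟨y, hy⟩, hyn⟩ := hl n
      rw [← hyn]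
      exact rat_int hy
    constructor
    · obtain ⟨m, hm⟩ := key 1
      refine ⟨-m, ?_⟩
      simp [hg, coeff_X_pow] at hm
      push_cast; linarith
    · obtain ⟨m, hm⟩ := key 0
      refine ⟨m, ?_⟩
      simpa [hg] using hm

/-- an order is recovered from its Gross lattice:
`O = {x : 2x ∈ ℤ + O^T, Nr(x) ∈ ℤ}`. -/
theorem order_from_gross (p q : ℕ) (hp : Nat.Prime p) (hodd : Odd p) (hq : Nat.Prime q)
    (hq8 : q % 8 = 3) (hqr : ∃ r : ℤ, (q : ℤ) ∣ r ^ 2 + p)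
    (O : Subring (Bq p q)) (hO : IsOrder O) :
    (O : Set (Bq p q)) = {x : Bq p q |
      (∃ a : ℤ, ∃ t ∈ GrossLat O, 2 * x = (a : Bq p q) + t) ∧ ∃ n : ℤ, Nrq x = n} := by
  have hint : ∀ x ∈ O, IsIntegral ℤ x := by
    intro x hx
    obtain ⟨⟨b⟩, -⟩ := hO
    haveI : Module.Finite ℤ O := Module.Finite.of_basis b
    have h := Algebra.IsIntegral.isIntegral (R := ℤ) (⟨x, hx⟩ : O)
    exact h.map (O.subtype.toIntAlgHom)
  ext x
  constructor
  · intro hx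
    obtain ⟨⟨n, hn⟩, hN⟩ := tr_nr x (hint x hx)
    refine ⟨⟨n, _, ⟨x, hx, rfl⟩, ?_⟩, hN⟩
    rw [hn]; simp
  · rintro ⟨⟨a, t, ⟨y, hy, rfl⟩, h⟩, n, hn⟩
    obtain ⟨⟨T, hT⟩, N, hN⟩ := tr_nr y (hint y hy)
    rw [hT] at h
    have hxy : x = y + algebraMap ℚ (Bq p q) (((a - T : ℤ) : ℚ) / 2) := by
      have h2 : (2 : ℚ) • x = (a : Bq p q) + ((2 : ℚ) • y - algebraMap ℚ (Bq p q) T) := by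
        rw [two_smul, two_smul, ← two_mul, ← two_mul]; exact h
      have e0 := congrArg QuaternionAlgebra.re h2
      have e1 := congrArg QuaternionAlgebra.imI h2
      have e2 := congrArg QuaternionAlgebra.imJ h2
      have e3 := congrArg QuaternionAlgebra.imK h2
      simp at e0 e1 e2 e3
      ext <;> simp [QuaternionAlgebra.algebraMap_eq, *]
      linarith
    generalize a - T = m at hxy
    have hE : (4 * n : ℚ) = 4 * N + 2 * m * T + m ^ 2 := by
      rw [← hn, ← hN, ← hT, Nrq_eq, Nrq_eq, hxy]
      simp [Trq, QuaternionAlgebra.algebraMap_eq]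
      ring
    have hE' : 4 * n = 4 * N + 2 * m * T + m ^ 2 := by exact_mod_cast hE
    have hm : Even m := by
      have : Even (m ^ 2) := ⟨2 * n - 2 * N - m * T, by linarith⟩
      exact (Int.even_pow.mp this).1
    obtain ⟨k, rfl⟩ := hm
    have : (((k + k : ℤ) : ℚ) / 2) = k := by push_cast; ring
    rw [hxy, this]
    simpa using O.add_mem hy (intCast_mem O k)
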